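/- arXiv:1402.0032 — 2 statements merged into one kernel-verified Lean document; each statement's English description precedes it below -/
import Mathlib

section
/- Let X = ℝ³ equipped with the ℓ^p norm for p = 4/3, and let V = span{v_1, v_2} ⊂ X where v_1 = (1,1,1) and v_2 = (−1,0,1). Let P_o ∈ 𝒫(X,V) be a projection of minimal operator norm, i.e. ‖P_o‖ = inf{‖P‖ : P ∈ 𝒫(X,V)}. Then P_o is not minimal with respect to numerical radius: there exists a projection Q ∈ 𝒫(X,V) with ‖Q‖_w < ‖P_o‖_w; in particular inf{‖P‖_w : P ∈ 𝒫(X,V)} < inf{‖P‖ : P ∈ 𝒫(X,V)}. -/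
open scoped ENNReal

instance : Fact ((1 : ℝ≥0∞) ≤ 4 / 3) := ⟨by
  rw [ENNReal.le_div_iff_mul_le (by norm_num) (by norm_num)]
  norm_num⟩

/-- `ℓ^p_3` : `ℝ³` equipped with the `ℓ^p` norm, for `p = 4/3`. -/
abbrev lp43 : Type := PiLp (4 / 3 : ℝ≥0∞) (fun _ : Fin 3 => ℝ)

/-- The numerical radius of a bounded linear operator `S` on a normed space `X`:
`‖S‖_w = sup {|x*(Sx)| : ‖x‖ = ‖x*‖ = 1, x*(x) = 1}`. -/
noncomputable def numericalRadius (X : Type*) [NormedAddCommGroup X]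
    [NormedSpace ℝ X] (S : X →L[ℝ] X) : ℝ :=
  sSup {r : ℝ | ∃ (x : X) (f : X →L[ℝ] ℝ), ‖x‖ = 1 ∧ ‖f‖ = 1 ∧ f x = 1 ∧ r = ‖f (S x)‖}

/-- The quartic form `∑ uᵢ⁴`, the fourth power of the `ℓ⁴` norm. -/
def quartic (u : Fin 3 → ℝ) : ℝ := ∑ i, u i ^ 4

/-- The vector of cubes, as an element of `ℓ^{4/3}_3`. -/
noncomputable def cubes (y : Fin 3 → ℝ) : lp43 := WithLp.toLp (4 / 3 : ℝ≥0∞) fun i => y i ^ 3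

/-- The functional on `ℓ^{4/3}_3` with coefficient vector `u`. -/
noncomputable def pairing (u : Fin 3 → ℝ) : lp43 →L[ℝ] ℝ :=
  ∑ i, u i • PiLp.proj (4 / 3 : ℝ≥0∞) (fun _ : Fin 3 => ℝ) i

/-- The operator `x ↦ x - (x₀ - 2 x₁ + x₂) z`. -/
noncomputable def planeProj (z : lp43) : lp43 →L[ℝ] lp43 :=
  ContinuousLinearMap.id ℝ lp43 - (pairing ![1, -2, 1]).smulRight z

lemma pairing_apply (u : Fin 3 → ℝ) (x : lp43) : pairing u x = ∑ i, u i * x i := by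
  simp [pairing]

lemma planeProj_apply (z x : lp43) (i : Fin 3) :
    planeProj z x i = x i - (x 0 - 2 * x 1 + x 2) * z i := by
  simp [planeProj, pairing_apply, Fin.sum_univ_three, sub_eq_add_neg]

lemma cubes_apply (y : Fin 3 → ℝ) (i : Fin 3) : cubes y i = y i ^ 3 := rfl

lemma quartic_nonneg (u : Fin 3 → ℝ) : 0 ≤ quartic u :=
  Finset.sum_nonneg fun i _ => by positivity

lemma norm_cubes_pow (y : Fin 3 → ℝ) : ‖cubes y‖ ^ 4 = quartic y ^ 3 := by
  have h43 : (4 / 3 : ℝ≥0∞).toReal = 4 / 3 := by simp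
  have hsum : ∑ i, ‖cubes y i‖ ^ (4 / 3 : ℝ) = quartic y := by
    refine Finset.sum_congr rfl fun i _ => ?_
    rw [cubes_apply, norm_pow, ← Real.rpow_natCast, ← Real.rpow_mul (norm_nonneg _)]
    norm_num
    exact Even.pow_abs (by decide) _
  rw [PiLp.norm_eq_sum (by rw [h43]; norm_num), h43, hsum, ← Real.rpow_natCast,
    ← Real.rpow_mul (quartic_nonneg y), ← Real.rpow_natCast (quartic y) 3]
  norm_num

lemma exists_pow_three_eq (r : ℝ) : ∃ y : ℝ, y ^ 3 = r := by
  rcases le_total 0 r with h | h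
  · exact ⟨r ^ ((3 : ℕ) : ℝ)⁻¹, Real.rpow_inv_natCast_pow h (by norm_num)⟩
  · refine ⟨-(-r) ^ ((3 : ℕ) : ℝ)⁻¹, ?_⟩
    rw [Odd.neg_pow (by decide), Real.rpow_inv_natCast_pow (by linarith) (by norm_num), neg_neg]

lemma exists_cubes_eq (x : lp43) : ∃ y, cubes y = x := by
  choose y hy using fun i => exists_pow_three_eq (x i)
  exact ⟨y, by ext i; rw [cubes_apply, hy]⟩

lemma pairing_cubes_pow_le (u y : Fin 3 → ℝ) :
    pairing u (cubes y) ^ 4 ≤ quartic u * quartic y ^ 3 := by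
  have h₁ : pairing u (cubes y) ^ 2 ≤ (∑ i, u i ^ 2 * y i ^ 2) * quartic y := by
    have := Finset.sum_mul_sq_le_sq_mul_sq Finset.univ (fun i => u i * y i) (fun i => y i ^ 2)
    simp only [pairing_apply, cubes_apply, quartic]
    calc (∑ i, u i * y i ^ 3) ^ 2 = (∑ i, u i * y i * y i ^ 2) ^ 2 := by
          simp only [pow_succ' (y _) 2, mul_assoc]
      _ ≤ _ := this
      _ = _ := by simp only [mul_pow, ← pow_mul]
  have h₂ : (∑ i, u i ^ 2 * y i ^ 2) ^ 2 ≤ quartic u * quartic y := by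
    have := Finset.sum_mul_sq_le_sq_mul_sq Finset.univ (fun i => u i ^ 2) (fun i => y i ^ 2)
    simp only [← pow_mul] at this
    exact this
  calc pairing u (cubes y) ^ 4 = (pairing u (cubes y) ^ 2) ^ 2 := by ring
    _ ≤ ((∑ i, u i ^ 2 * y i ^ 2) * quartic y) ^ 2 := by gcongr
    _ = (∑ i, u i ^ 2 * y i ^ 2) ^ 2 * quartic y ^ 2 := by ring
    _ ≤ quartic u * quartic y * quartic y ^ 2 := by gcongr
    _ = quartic u * quartic y ^ 3 := by ring

lemma pairing_self_cubes (y : Fin 3 → ℝ) : pairing y (cubes y) = quartic y := by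
  simp only [pairing_apply, cubes_apply, quartic]
  exact Finset.sum_congr rfl fun i _ => by ring

lemma pow_three_le_of_pow_four_le {a b : ℝ} (ha : 0 ≤ a) (hb : 0 ≤ b) (h : a ^ 4 ≤ b * a) :
    a ^ 3 ≤ b := by
  rcases ha.eq_or_lt with rfl | ha
  · simpa using hb
  · exact le_of_mul_le_mul_right (by linarith [pow_succ a 3]) ha

/-- A bound for the adjoint on `ℓ⁴` gives a bound for the operator on `ℓ^{4/3}`. -/
lemma opNorm_pow_le {P : lp43 →L[ℝ] lp43} {A : (Fin 3 → ℝ) → Fin 3 → ℝ}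
    (hA : ∀ u x, pairing u (P x) = pairing (A u) x) {n : ℝ} (hn : 0 ≤ n)
    (h : ∀ u, quartic (A u) ≤ n * quartic u) : ‖P‖ ^ 4 ≤ n := by
  have key : ∀ x, ‖P x‖ ^ 4 ≤ n * ‖x‖ ^ 4 := by
    intro x
    obtain ⟨y, rfl⟩ := exists_cubes_eq x
    obtain ⟨u, hu⟩ := exists_cubes_eq (P (cubes y))
    have h₁ : quartic u ^ 4 ≤ quartic (A u) * quartic y ^ 3 := by
      rw [← pairing_self_cubes u, hu, hA]
      exact pairing_cubes_pow_le _ _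
    have h₂ : quartic (A u) * quartic y ^ 3 ≤ n * quartic u * quartic y ^ 3 :=
      mul_le_mul_of_nonneg_right (h u) (pow_nonneg (quartic_nonneg y) 3)
    rw [← hu, norm_cubes_pow, norm_cubes_pow]
    exact pow_three_le_of_pow_four_le (quartic_nonneg u)
      (mul_nonneg hn (pow_nonneg (quartic_nonneg y) 3)) (by linarith)
  have hroot : (n ^ ((4 : ℕ) : ℝ)⁻¹) ^ 4 = n := Real.rpow_inv_natCast_pow hn (by norm_num)
  have hroot0 : 0 ≤ n ^ ((4 : ℕ) : ℝ)⁻¹ := Real.rpow_nonneg hn _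
  have hle : ‖P‖ ≤ n ^ ((4 : ℕ) : ℝ)⁻¹ := by
    refine P.opNorm_le_bound hroot0 fun x => ?_
    refine le_of_pow_le_pow_left₀ (n := 4) (by norm_num) (by positivity) ?_
    rw [mul_pow, hroot]
    exact key x
  calc ‖P‖ ^ 4 ≤ (n ^ ((4 : ℕ) : ℝ)⁻¹) ^ 4 := by gcongr
    _ = n := hroot

/-- The norm of an operator on `ℓ^{4/3}` dominates that of its adjoint on `ℓ⁴`. -/
lemma quartic_adjoint_le {P : lp43 →L[ℝ] lp43} {u w : Fin 3 → ℝ}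
    (hw : ∀ x, pairing u (P x) = pairing w x) : quartic w ≤ ‖P‖ ^ 4 * quartic u := by
  obtain ⟨k, hk⟩ := exists_cubes_eq (P (cubes w))
  have h₁ : quartic w ^ 4 ≤ quartic u * ‖P (cubes w)‖ ^ 4 := by
    rw [← pairing_self_cubes w, ← hw, ← hk, norm_cubes_pow]
    exact pairing_cubes_pow_le _ _
  have h₂ : ‖P (cubes w)‖ ^ 4 ≤ ‖P‖ ^ 4 * quartic w ^ 3 := by
    rw [← norm_cubes_pow, ← mul_pow]
    gcongr
    exact P.le_opNorm _
  have h₃ := mul_le_mul_of_nonneg_left h₂ (quartic_nonneg u)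
  have hb : 0 ≤ ‖P‖ ^ 4 * quartic u := mul_nonneg (by positivity) (quartic_nonneg u)
  rcases (quartic_nonneg w).eq_or_lt with h0 | h0
  · rwa [← h0]
  · refine le_of_mul_le_mul_right ?_ (pow_pos h0 3)
    linarith [pow_succ' (quartic w) 3]

lemma norm_eq_one_of_pow_four {a : ℝ} (ha : 0 ≤ a) (h : a ^ 4 = 1) : a = 1 :=
  (pow_eq_one_iff_of_nonneg ha (by norm_num)).1 h

lemma norm_pairing_le (u : Fin 3 → ℝ) : ‖pairing u‖ ^ 4 ≤ quartic u := by
  have hroot : (quartic u ^ ((4 : ℕ) : ℝ)⁻¹) ^ 4 = quartic u :=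
    Real.rpow_inv_natCast_pow (quartic_nonneg u) (by norm_num)
  have hroot0 : 0 ≤ quartic u ^ ((4 : ℕ) : ℝ)⁻¹ := Real.rpow_nonneg (quartic_nonneg u) _
  have hle : ‖pairing u‖ ≤ quartic u ^ ((4 : ℕ) : ℝ)⁻¹ := by
    refine (pairing u).opNorm_le_bound hroot0 fun x => ?_
    obtain ⟨y, rfl⟩ := exists_cubes_eq x
    refine le_of_pow_le_pow_left₀ (n := 4) (by norm_num) (by positivity) ?_
    rw [mul_pow, hroot, norm_cubes_pow, Real.norm_eq_abs, Even.pow_abs (by decide)]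
    exact pairing_cubes_pow_le u y
  calc ‖pairing u‖ ^ 4 ≤ (quartic u ^ ((4 : ℕ) : ℝ)⁻¹) ^ 4 := by gcongr
    _ = quartic u := hroot

lemma quartic_le_norm_pairing (u : Fin 3 → ℝ) : quartic u ≤ ‖pairing u‖ ^ 4 := by
  have h₁ : quartic u ^ 4 ≤ ‖pairing u‖ ^ 4 * quartic u ^ 3 := by
    rw [← norm_cubes_pow, ← mul_pow, ← pairing_self_cubes u]
    refine pow_le_pow_left₀ ?_ ((le_abs_self _).trans ((pairing u).le_opNorm _)) 4
    rw [pairing_self_cubes]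
    exact quartic_nonneg u
  rcases (quartic_nonneg u).eq_or_lt with h0 | h0
  · rw [← h0]; positivity
  · refine le_of_mul_le_mul_right ?_ (pow_pos h0 3)
    linarith [pow_succ' (quartic u) 3]

lemma exists_pairing_eq (f : lp43 →L[ℝ] ℝ) : ∃ u, pairing u = f := by
  refine ⟨fun i => f (PiLp.single (4 / 3 : ℝ≥0∞) i 1), ?_⟩
  ext x
  have hx : x = ∑ i, x i • (PiLp.single (4 / 3 : ℝ≥0∞) i (1 : ℝ) : lp43) := by
    ext j
    fin_cases j <;> simp [Fin.sum_univ_three]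
  conv_rhs => rw [hx]
  simp [pairing_apply, mul_comm]

/-- Norming functionals are unique: on the unit sphere, the one at `y³` is `y`. -/
lemma eq_of_pairing_cubes_eq_one {u y : Fin 3 → ℝ} (hu : quartic u ≤ 1) (hy : quartic y = 1)
    (h : pairing u (cubes y) = 1) : u = y := by
  have hid : ∀ a b : ℝ, a ^ 4 + 3 * b ^ 4 - 4 * (a * b ^ 3)
      = (a - b) ^ 2 * ((a + b) ^ 2 + 2 * b ^ 2) := fun a b => by ring
  have hnn : ∀ i ∈ Finset.univ, 0 ≤ u i ^ 4 + 3 * y i ^ 4 - 4 * (u i * y i ^ 3) :=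
    fun i _ => by rw [hid]; positivity
  have hsum : ∑ i, (u i ^ 4 + 3 * y i ^ 4 - 4 * (u i * y i ^ 3)) = 0 := by
    refine le_antisymm ?_ (Finset.sum_nonneg hnn)
    simp only [pairing_apply, cubes_apply] at h
    simp only [quartic] at hu hy
    rw [Finset.sum_sub_distrib, Finset.sum_add_distrib, ← Finset.mul_sum, ← Finset.mul_sum, h, hy]
    linarith
  ext i
  have hi := (Finset.sum_eq_zero_iff_of_nonneg hnn).1 hsum i (Finset.mem_univ i)
  rw [hid] at hi
  rcases mul_eq_zero.1 hi with h0 | h0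
  · exact sub_eq_zero.1 (pow_eq_zero_iff (by norm_num) |>.1 h0)
  · have hy0 : y i = 0 := by nlinarith [sq_nonneg (u i + y i), sq_nonneg (y i)]
    have hu0 : u i + y i = 0 := by nlinarith [sq_nonneg (u i + y i), sq_nonneg (y i)]
    linarith

lemma numericalRadius_le_of_quartic {P : lp43 →L[ℝ] lp43} {w : ℝ} (hw : 0 ≤ w)
    (h : ∀ y, |pairing y (P (cubes y))| ≤ w * quartic y) : numericalRadius lp43 P ≤ w := by
  refine Real.sSup_le ?_ hw
  rintro r ⟨x, f, hx, hf, hfx, rfl⟩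
  obtain ⟨y, rfl⟩ := exists_cubes_eq x
  obtain ⟨u, rfl⟩ := exists_pairing_eq f
  have hy : quartic y = 1 := by
    refine (pow_eq_one_iff_of_nonneg (quartic_nonneg y) (n := 3) (by norm_num)).1 ?_
    rw [← norm_cubes_pow, hx, one_pow]
  have hu : quartic u ≤ 1 := by simpa [hf] using quartic_le_norm_pairing u
  obtain rfl := eq_of_pairing_cubes_eq_one hu hy hfx
  simpa [hy] using h u

lemma opNorm_mem_upperBounds_numericalRange (P : lp43 →L[ℝ] lp43) :
    ‖P‖ ∈ upperBounds {r : ℝ | ∃ (x : lp43) (f : lp43 →L[ℝ] ℝ),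
      ‖x‖ = 1 ∧ ‖f‖ = 1 ∧ f x = 1 ∧ r = ‖f (P x)‖} := by
  rintro r ⟨x, f, hx, hf, -, rfl⟩
  calc ‖f (P x)‖ ≤ ‖f‖ * (‖P‖ * ‖x‖) := f.le_opNorm_of_le (P.le_opNorm x)
    _ = ‖P‖ := by rw [hf, hx]; ring

lemma numericalRadius_le_opNorm (P : lp43 →L[ℝ] lp43) : numericalRadius lp43 P ≤ ‖P‖ :=
  Real.sSup_le (opNorm_mem_upperBounds_numericalRange P) (norm_nonneg P)

lemma numericalRadius_nonneg (P : lp43 →L[ℝ] lp43) : 0 ≤ numericalRadius lp43 P := by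
  refine Real.sSup_nonneg ?_
  rintro r ⟨x, f, -, -, -, rfl⟩
  exact norm_nonneg _

lemma abs_pairing_le_numericalRadius (P : lp43 →L[ℝ] lp43) (y : Fin 3 → ℝ) (hy : 0 < quartic y) :
    |pairing y (P (cubes y))| ≤ numericalRadius lp43 P * quartic y := by
  set t : ℝ := (quartic y)⁻¹ ^ ((4 : ℕ) : ℝ)⁻¹
  have ht4 : t ^ 4 = (quartic y)⁻¹ := Real.rpow_inv_natCast_pow (by positivity) (by norm_num)
  have hq : quartic (t • y) = 1 := by
    have : quartic (t • y) = t ^ 4 * quartic y := by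
      simp only [quartic, Finset.mul_sum, Pi.smul_apply, smul_eq_mul, mul_pow]
    rw [this, ht4, inv_mul_cancel₀ hy.ne']
  have hmem := le_csSup ⟨‖P‖, opNorm_mem_upperBounds_numericalRange P⟩
    (⟨cubes (t • y), pairing (t • y), norm_eq_one_of_pow_four (norm_nonneg _) (by
        rw [norm_cubes_pow, hq, one_pow]), norm_eq_one_of_pow_four (norm_nonneg _)
        (le_antisymm (hq ▸ norm_pairing_le _) (hq ▸ quartic_le_norm_pairing _)),
        by rw [pairing_self_cubes, hq], rfl⟩ :
      ‖pairing (t • y) (P (cubes (t • y)))‖ ∈ {r : ℝ | ∃ (x : lp43) (f : lp43 →L[ℝ] ℝ),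
        ‖x‖ = 1 ∧ ‖f‖ = 1 ∧ f x = 1 ∧ r = ‖f (P x)‖})
  have hc : cubes (t • y) = t ^ 3 • cubes y := by
    ext i
    simp [cubes_apply, mul_pow]
  have hp : pairing (t • y) (P (cubes (t • y))) = t ^ 4 * pairing y (P (cubes y)) := by
    rw [hc, map_smul, map_smul]
    simp only [pairing_apply, Pi.smul_apply, smul_eq_mul, Finset.mul_sum]
    exact Finset.sum_congr rfl fun i _ => by ring
  rw [hp, ht4, Real.norm_eq_abs, abs_mul, abs_of_pos (inv_pos.2 hy), inv_mul_le_iff₀ hy,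
    mul_comm] at hmem
  exact hmem

lemma pairing_planeProj (z : lp43) (u : Fin 3 → ℝ) (x : lp43) :
    pairing u (planeProj z x) = pairing (u - pairing u z • ![1, -2, 1]) x := by
  simp only [pairing_apply, planeProj_apply, Fin.sum_univ_three, Pi.sub_apply, Pi.smul_apply,
    smul_eq_mul, Matrix.cons_val_zero, Matrix.cons_val_one, Matrix.cons_val]
  ring

lemma mem_span_plane_iff (x : lp43) :
    x ∈ Submodule.span ℝ {(WithLp.equiv (4 / 3 : ℝ≥0∞) (Fin 3 → ℝ)).symm ![1, 1, 1],
      (WithLp.equiv (4 / 3 : ℝ≥0∞) (Fin 3 → ℝ)).symm ![-1, 0, 1]} ↔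
      x 0 - 2 * x 1 + x 2 = 0 := by
  rw [Submodule.mem_span_pair]
  constructor
  · rintro ⟨a, b, rfl⟩
    simp
    ring
  · intro h
    refine ⟨x 1, x 1 - x 0, ?_⟩
    ext i
    fin_cases i
    · simp
    · simp
    · simp
      linarith

/-- The symmetric vector `(s, s - 1/2, s)`, on which `x₀ - 2 x₁ + x₂` takes the value `1`. -/
noncomputable def symmVec (s : ℝ) : lp43 := WithLp.toLp (4 / 3 : ℝ≥0∞) ![s, s - 1 / 2, s]

lemma planeProj_plane (z x : lp43) (hz : z 0 - 2 * z 1 + z 2 = 1) :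
    planeProj z x 0 - 2 * planeProj z x 1 + planeProj z x 2 = 0 := by
  simp only [planeProj_apply]
  linear_combination -(x 0 - 2 * x 1 + x 2) * hz

lemma planeProj_eq_self (z x : lp43) (hx : x 0 - 2 * x 1 + x 2 = 0) : planeProj z x = x := by
  ext i
  rw [planeProj_apply, hx, zero_mul, sub_zero]

lemma symmVec_plane (s : ℝ) : symmVec s 0 - 2 * symmVec s 1 + symmVec s 2 = 1 := by
  simp [symmVec]
  ring

lemma exists_eq_planeProj {P : lp43 →L[ℝ] lp43}
    (hP : ∀ x, P x 0 - 2 * P x 1 + P x 2 = 0)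
    (hP' : ∀ x : lp43, x 0 - 2 * x 1 + x 2 = 0 → P x = x) :
    ∃ z : lp43, z 0 - 2 * z 1 + z 2 = 1 ∧ P = planeProj z := by
  set e : lp43 := WithLp.toLp (4 / 3 : ℝ≥0∞) ![1, 0, 0]
  have he0 : e 0 = 1 := rfl
  have he1 : e 1 = 0 := rfl
  have he2 : e 2 = 0 := rfl
  refine ⟨e - P e, ?_, ?_⟩
  · have := hP e
    simp only [PiLp.sub_apply, he0, he1, he2]
    linarith
  · ext x i
    have h := hP' (x - (x 0 - 2 * x 1 + x 2) • e) (by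
      simp only [PiLp.sub_apply, PiLp.smul_apply, he0, he1, he2, smul_eq_mul]
      ring)
    rw [map_sub, map_smul] at h
    have hi := congrArg (fun v : lp43 => v i) h
    simp only [PiLp.sub_apply, PiLp.smul_apply, smul_eq_mul] at hi
    rw [planeProj_apply, PiLp.sub_apply]
    linarith

lemma opNorm_planeProj_symmVec_le : ‖planeProj (symmVec (263 / 1250))‖ ^ 4 ≤ 6143 / 5000 := by
  refine opNorm_pow_le (fun u x => pairing_planeProj _ u x) (by norm_num) fun u => ?_
  simp only [pairing_apply, symmVec, quartic, Fin.sum_univ_three, Pi.sub_apply, Pi.smul_apply,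
    smul_eq_mul, Matrix.cons_val_zero, Matrix.cons_val_one, Matrix.cons_val]
  generalize u 0 = a, u 1 = b, u 2 = c
  rw [← sub_nonneg]
  refine le_of_le_of_eq (b :=
      1056177183983/610351562500 * (
          1/4 * (a + c) ^ 2 -
          221789337696/1056177183983 * (a + c) * b -
          1220787934963/2112354367966 * b ^ 2 +
          871294140625/8449417471864 * (a - c) ^ 2) ^ 2 +
      389859807751474054974461/644639394520874023437500 * (
          1/2 * (a + c) * b -
          387882166625319246926832/389859807751474054974461 * b ^ 2 +
          98931025076137451171875/779719615502948109948922 * (a - c) ^ 2) ^ 2 +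
      6241881647661429169888772548460587/951806171268247204527492675781250000 * (
          b ^ 2 -
          5070703593807267753885398337109375/24967526590645716679555090193842348 *
            (a - c) ^ 2) ^ 2 +
      83838395947797078725713109822698757/31209408238307145849443862742302935000 * (
          1/4 * (a - c) ^ 2) ^ 2 +
      929/100 * (1/4 * (a + c) * (a - c) - 101/929 * b * (a - c)) ^ 2 +
      18/23225 * (1/2 * b * (a - c)) ^ 2) (by positivity) (by ring)

lemma numericalRadius_planeProj_symmVec_le :
    numericalRadius lp43 (planeProj (symmVec (1057 / 5000))) ≤ 10277 / 10000 := by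
  refine numericalRadius_le_of_quartic (by norm_num) fun y => ?_
  simp only [pairing_planeProj]
  simp only [pairing_apply, cubes_apply, symmVec, quartic, Fin.sum_univ_three, Pi.sub_apply,
    Pi.smul_apply, smul_eq_mul, Matrix.cons_val_zero, Matrix.cons_val_one, Matrix.cons_val]
  generalize y 0 = a, y 1 = b, y 2 = c
  rw [abs_le]
  constructor
  · rw [← sub_nonneg]
    refine le_of_le_of_eq (b :=
      16049/5000 * (
          1/4 * (a + c) ^ 2 +
          1443/32098 * (a + c) * b -
          6000/16049 * b ^ 2 +
          3989/64196 * (a - c) ^ 2) ^ 2 +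
      190505751/80245000 * (
          1/2 * (a + c) * b +
          42585586/190505751 * b ^ 2 -
          5429001/127003834 * (a - c) ^ 2) ^ 2 +
      1682628036647/1905057510000 * (b ^ 2 - 457688426283/1682628036647 * (a - c) ^ 2) ^ 2 +
      2883710396157067/1051642522904375 * (1/4 * (a - c) ^ 2) ^ 2 +
      101/5 * (1/4 * (a + c) * (a - c) + 3/101 * b * (a - c)) ^ 2 +
      531/202 * (1/2 * b * (a - c)) ^ 2) (by positivity) (by ring)
  · rw [← sub_nonneg]
    refine le_of_le_of_eq (b :=
      901/1000 * (
          1/4 * (a + c) ^ 2 -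
          1443/9010 * (a + c) * b -
          751/1802 * b ^ 2 +
          399/9010 * (a - c) ^ 2) ^ 2 +
      7417013/11262500 * (
          1/2 * (a + c) * b -
          24465605/29668052 * b ^ 2 +
          3003069/59336104 * (a - c) ^ 2) ^ 2 +
      166604713/296680520000 * (b ^ 2 - 6271093/333209426 * (a - c) ^ 2) ^ 2 +
      28236837/208255891250 * (1/4 * (a - c) ^ 2) ^ 2 +
      51/20 * (1/4 * (a + c) * (a - c) - 79/425 * b * (a - c)) ^ 2 +
      241/425000 * (1/2 * b * (a - c)) ^ 2) (by positivity) (by ring)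

lemma add_le_of_opNorm_planeProj_le {z : lp43} (hz : z 0 - 2 * z 1 + z 2 = 1)
    (h : ‖planeProj z‖ ^ 4 ≤ 6143 / 5000) : z 0 + z 2 ≤ 4213 / 10000 := by
  have h₁ := quartic_adjoint_le (pairing_planeProj z 1)
  simp only [pairing_apply, quartic, Fin.sum_univ_three, Pi.sub_apply, Pi.smul_apply,
    smul_eq_mul, Matrix.cons_val_zero, Matrix.cons_val_one, Matrix.cons_val, Pi.one_apply] at h₁
  set d := z 0 + z 1 + z 2 with hd
  have hzd : z 0 + z 2 = (2 * d + 1) / 3 := by linarith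
  have h₂ : 2 * (1 - d) ^ 4 + (1 + 2 * d) ^ 4 ≤ 3 * (6143 / 5000) := by
    linarith
  rw [hzd]
  by_contra! hlt
  have hd0 : 2639 / 20000 < d := by linarith
  have e₁ : ∀ t t₀ : ℝ, t₀ ^ 4 + 4 * t₀ ^ 3 * (t - t₀) ≤ t ^ 4 := fun t t₀ => by
    have : t ^ 4 - (t₀ ^ 4 + 4 * t₀ ^ 3 * (t - t₀))
      = (t - t₀) ^ 2 * ((t + t₀) ^ 2 + 2 * t₀ ^ 2) := by ring
    have : 0 ≤ (t - t₀) ^ 2 * ((t + t₀) ^ 2 + 2 * t₀ ^ 2) := by positivity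
    linarith
  linarith [e₁ (1 - d) (1 - 2639 / 20000), e₁ (1 + 2 * d) (1 + 2 * (2639 / 20000))]

lemma lt_numericalRadius_planeProj {z : lp43} (hz : z 0 - 2 * z 1 + z 2 = 1)
    (h : z 0 + z 2 ≤ 4213 / 10000) : 10277 / 10000 < numericalRadius lp43 (planeProj z) := by
  have h₁ := abs_pairing_le_numericalRadius (planeProj z) ![1, 107 / 200, -3 / 5]
    (by simp [quartic, Fin.sum_univ_three]; norm_num)
  have h₂ := abs_pairing_le_numericalRadius (planeProj z) ![-3 / 5, 107 / 200, 1]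
    (by simp [quartic, Fin.sum_univ_three]; norm_num)
  replace h₁ := (le_abs_self _).trans h₁
  replace h₂ := (le_abs_self _).trans h₂
  simp only [pairing_planeProj] at h₁ h₂
  simp only [pairing_apply, cubes_apply, quartic, Fin.sum_univ_three, Pi.sub_apply, Pi.smul_apply,
    smul_eq_mul, Matrix.cons_val_zero, Matrix.cons_val_one, Matrix.cons_val] at h₁ h₂
  linarith

/-- In `ℓ^p_3` with `p = 4/3`, a projection of minimal operator norm onto
`V = span {(1,1,1), (-1,0,1)}` is not minimal with respect to numerical radius; in
particular the minimal numerical radius is strictly smaller than the minimal operator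
norm of projections onto `V`. -/
theorem minimal_norm_projection_not_minimal_numericalRadius
    (v₁ : lp43) (hv₁ : v₁ = (WithLp.equiv (4 / 3 : ℝ≥0∞) (Fin 3 → ℝ)).symm ![1, 1, 1])
    (v₂ : lp43) (hv₂ : v₂ = (WithLp.equiv (4 / 3 : ℝ≥0∞) (Fin 3 → ℝ)).symm ![-1, 0, 1])
    (V : Submodule ℝ lp43) (hV : V = Submodule.span ℝ {v₁, v₂})
    (Po : lp43 →L[ℝ] lp43) (hPoRange : ∀ x, Po x ∈ V) (hPoProj : ∀ v ∈ V, Po v = v)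
    (hPoMin : ‖Po‖ = sInf {r : ℝ | ∃ P : lp43 →L[ℝ] lp43,
      (∀ x, P x ∈ V) ∧ (∀ v ∈ V, P v = v) ∧ r = ‖P‖}) :
    (∃ Q : lp43 →L[ℝ] lp43, (∀ x, Q x ∈ V) ∧ (∀ v ∈ V, Q v = v) ∧
      numericalRadius lp43 Q < numericalRadius lp43 Po) ∧
    sInf {r : ℝ | ∃ P : lp43 →L[ℝ] lp43, (∀ x, P x ∈ V) ∧ (∀ v ∈ V, P v = v) ∧
        r = numericalRadius lp43 P} <
      sInf {r : ℝ | ∃ P : lp43 →L[ℝ] lp43, (∀ x, P x ∈ V) ∧ (∀ v ∈ V, P v = v) ∧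
        r = ‖P‖} := by
  subst hv₁ hv₂ hV
  simp only [mem_span_plane_iff] at *
  obtain ⟨z, hz, rfl⟩ := exists_eq_planeProj hPoRange hPoProj
  have hnorm : ‖planeProj z‖ ≤ ‖planeProj (symmVec (263 / 1250))‖ := by
    rw [hPoMin]
    refine csInf_le ⟨0, ?_⟩ ⟨_, fun x => planeProj_plane _ x (symmVec_plane _),
      fun v hv => planeProj_eq_self _ v hv, rfl⟩
    rintro r ⟨P, -, -, rfl⟩
    exact norm_nonneg P
  have hnorm4 : ‖planeProj z‖ ^ 4 ≤ 6143 / 5000 :=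
    (pow_le_pow_left₀ (norm_nonneg _) hnorm 4).trans opNorm_planeProj_symmVec_le
  have hlt := numericalRadius_planeProj_symmVec_le.trans_lt
    (lt_numericalRadius_planeProj hz (add_le_of_opNorm_planeProj_le hz hnorm4))
  have hQ : ∃ Q : lp43 →L[ℝ] lp43, (∀ x, Q x 0 - 2 * Q x 1 + Q x 2 = 0) ∧
      (∀ v : lp43, v 0 - 2 * v 1 + v 2 = 0 → Q v = v) ∧
      numericalRadius lp43 Q < numericalRadius lp43 (planeProj z) :=
    ⟨_, fun x => planeProj_plane _ x (symmVec_plane _),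
      fun v hv => planeProj_eq_self _ v hv, hlt⟩
  refine ⟨hQ, ?_⟩
  obtain ⟨Q, hQ₁, hQ₂, hQ₃⟩ := hQ
  rw [← hPoMin]
  refine lt_of_le_of_lt (csInf_le ⟨0, ?_⟩ ⟨Q, hQ₁, hQ₂, rfl⟩)
    (hQ₃.trans_le (numericalRadius_le_opNorm _))
  rintro r ⟨P, -, -, rfl⟩
  exact numericalRadius_nonneg P
end

section
/- Let X be a three-dimensional real Banach space and V a two-dimensional subspace of X. Fix A ∈ B(V) with ‖A‖_w > 0, and set λ_w^A = inf{‖B‖_w : B ∈ 𝒫_A(X,V)}. Assume λ_w^A > ‖A‖, where ‖A‖ denotes the operator norm of A. Then there exists exactly one A_o ∈ 𝒫_A(X,V) such that ‖A_o‖_w = λ_w^A. Moreover, A_o is a strongly unique minimal extension with respect to numerical radius: there exists r > 0 such that ‖B‖_w ≥ ‖A_o‖_w + r·‖B − A_o‖_w for every B ∈ 𝒫_A(X,V). -/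
open Filter Topology

/-- One-sided perturbation: if `a ≤ l` on a compact set while `a + t b` reaches `l` for every
`t > 0`, then `b` is nonnegative somewhere on the level set `a = l`. -/
lemma exists_eq_nonneg_of_perturbation {Y : Type*} [MetricSpace Y] {C : Set Y} (hC : IsCompact C)
    {a b : Y → ℝ} (ha : Continuous a) (hb : Continuous b) {l : ℝ} (hle : ∀ z ∈ C, a z ≤ l)
    (h : ∀ t : ℝ, 0 < t → ∃ z ∈ C, l ≤ a z + t * b z) :
    ∃ z ∈ C, a z = l ∧ 0 ≤ b z := by
  have hpos : ∀ n : ℕ, (0 : ℝ) < 1 / ((n : ℝ) + 1) := fun n => by positivity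
  choose z hzC hz using fun n : ℕ => h _ (hpos n)
  obtain ⟨z₀, hz₀, k, hk, hlim⟩ := hC.tendsto_subseq hzC
  have hat : Tendsto (fun n => a (z (k n))) atTop (𝓝 (a z₀)) := (ha.tendsto z₀).comp hlim
  have hbt : Tendsto (fun n => b (z (k n))) atTop (𝓝 (b z₀)) := (hb.tendsto z₀).comp hlim
  have ht : Tendsto (fun n => 1 / (((k n : ℕ) : ℝ) + 1)) atTop (𝓝 0) :=
    (tendsto_one_div_add_atTop_nhds_zero_nat (𝕜 := ℝ)).comp hk.tendsto_atTop
  refine ⟨z₀, hz₀, le_antisymm (hle _ hz₀) ?_, ?_⟩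
  · have hsum := hat.add (ht.mul hbt)
    rw [zero_mul, add_zero] at hsum
    exact ge_of_tendsto' hsum fun n => hz (k n)
  · refine ge_of_tendsto' hbt fun n => ?_
    have h1 := hz (k n)
    have h2 := hle _ (hzC (k n))
    have h3 : 0 ≤ 1 / (((k n : ℕ) : ℝ) + 1) * b (z (k n)) := by linarith
    exact nonneg_of_mul_nonneg_right h3 (hpos (k n))

/-- In dimension two, a minimum of a maximum of affine functions is strongly unique as soon as no
two active linear parts are opposite. -/
lemma exists_pos_strong_minimum {Y V : Type*} [MetricSpace Y] [NormedAddCommGroup V]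
    [NormedSpace ℝ V] (hV : Module.finrank ℝ V = 2) {C : Set Y} (hC : IsCompact C)
    {a : Y → ℝ} {φ : Y → V →L[ℝ] ℝ} (ha : Continuous a) (hφ : Continuous φ) {l : ℝ}
    (hle : ∀ z ∈ C, a z ≤ l) (hmin : ∀ v, ∃ z ∈ C, l ≤ a z + φ z v)
    (hopp : ∀ z ∈ C, ∀ z' ∈ C, a z = l → a z' = l → ∀ c : ℝ, 0 ≤ c → φ z ≠ -(c • φ z')) :
    ∃ m > 0, ∀ v, ∃ z ∈ C, a z = l ∧ m * ‖v‖ ≤ φ z v := by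
  have : FiniteDimensional ℝ V := FiniteDimensional.of_finrank_pos (by omega)
  have : ProperSpace V := FiniteDimensional.proper_real V
  have hφv : ∀ v, Continuous fun z => φ z v := fun v => hφ.clm_apply continuous_const
  set D : Set Y := {z | z ∈ C ∧ a z = l}
  have hD : IsCompact D := hC.inter_right (isClosed_eq ha continuous_const)
  have kolmogorov : ∀ w, ∃ z ∈ D, 0 ≤ φ z w := fun w => by
    obtain ⟨z, hz, hal, hw⟩ := exists_eq_nonneg_of_perturbation hC ha (hφv w) hle fun t _ => by
      simpa using hmin (t • w)
    exact ⟨z, ⟨hz, hal⟩, hw⟩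
  have strict : ∀ v, v ≠ 0 → ∃ z ∈ D, 0 < φ z v := by
    intro v hv
    by_contra! hneg
    have key : ∀ w, ∃ z ∈ D, φ z v = 0 ∧ 0 ≤ φ z w := fun w =>
      exists_eq_nonneg_of_perturbation hD (hφv v) (hφv w) hneg fun t _ => by
        simpa using kolmogorov (v + t • w)
    obtain ⟨w, hw⟩ : ∃ w, w ∉ Submodule.span ℝ {v} := by
      by_contra! hall
      have htop : Submodule.span ℝ {v} = ⊤ := by ext w; simp [hall w]
      have := finrank_span_singleton (K := ℝ) hv
      rw [htop, finrank_top, hV] at this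
      omega
    have hli : LinearIndependent ℝ ![v, w] := by
      rw [LinearIndependent.pair_iff' hv]
      intro s hs
      exact hw (hs ▸ Submodule.smul_mem _ _ (Submodule.mem_span_singleton_self v))
    have hspan := hli.span_eq_top_of_card_eq_finrank' (by simp [hV])
    have hext : ∀ f₁ f₂ : V →L[ℝ] ℝ, f₁ v = f₂ v → f₁ w = f₂ w → f₁ = f₂ := by
      intro f₁ f₂ h₁ h₂
      apply ContinuousLinearMap.coe_injective
      apply LinearMap.ext_on_range hspan
      intro i
      fin_cases i <;> simpa
    obtain ⟨z, hz, hzv, hzw⟩ := key w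
    obtain ⟨z', hz', hzv', hzw'⟩ := key (-w)
    have hzw'' : φ z' w ≤ 0 := by simpa using hzw'
    have hne : φ z' w ≠ 0 := fun h0 =>
      hopp z' hz'.1 z hz.1 hz'.2 hz.2 0 le_rfl (hext _ _ (by simp [hzv']) (by simp [h0]))
    refine hopp z hz.1 z' hz'.1 hz.2 hz'.2 (φ z w / -φ z' w)
      (div_nonneg hzw (by linarith)) (hext _ _ (by simp [hzv, hzv']) ?_)
    simp only [neg_apply, smul_apply, smul_eq_mul]
    field_simp
  suffices hm : ∃ m > 0, ∀ v, ‖v‖ = 1 → ∃ z ∈ D, m ≤ φ z v by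
    obtain ⟨m, hm0, hm⟩ := hm
    refine ⟨m, hm0, fun v => ?_⟩
    rcases eq_or_ne v 0 with rfl | hv
    · obtain ⟨z, hz, -⟩ := kolmogorov 0
      exact ⟨z, hz.1, hz.2, by simp⟩
    · have hn : 0 < ‖v‖ := norm_pos_iff.mpr hv
      obtain ⟨z, hz, hmz⟩ := hm (‖v‖⁻¹ • v) (by simp [norm_smul, hn.ne'])
      refine ⟨z, hz.1, hz.2, ?_⟩
      rw [map_smul, smul_eq_mul, inv_mul_eq_div, le_div_iff₀ hn] at hmz
      exact hmz
  by_contra! hcon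
  have hpos : ∀ n : ℕ, (0 : ℝ) < 1 / ((n : ℝ) + 1) := fun n => by positivity
  choose v hv1 hv using fun n : ℕ => hcon _ (hpos n)
  obtain ⟨v₀, hv₀, k, hk, hlim⟩ := (isCompact_sphere (0 : V) 1).tendsto_subseq (x := v)
    fun n => by simp [hv1]
  have ht : Tendsto (fun n => 1 / (((k n : ℕ) : ℝ) + 1)) atTop (𝓝 0) :=
    (tendsto_one_div_add_atTop_nhds_zero_nat (𝕜 := ℝ)).comp hk.tendsto_atTop
  obtain ⟨z, hz, hpz⟩ := strict v₀ (by rintro rfl; simp at hv₀)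
  have hle0 : φ z v₀ ≤ 0 :=
    le_of_tendsto_of_tendsto' (((φ z).continuous.tendsto v₀).comp hlim) ht
      fun n => (hv (k n) z hz).le
  exact absurd hpz hle0.not_gt

section NumericalRadius

variable {X : Type*} [NormedAddCommGroup X] [NormedSpace ℝ X]

/-- Norm-one pairs `(x, f)` with `|f x| = 1`; allowing either sign makes the numerical radius a
supremum of the linear functionals `S ↦ f (S x)`. -/
def signedStates (X : Type*) [NormedAddCommGroup X] [NormedSpace ℝ X] : Set (X × (X →L[ℝ] ℝ)) :=
  {p | ‖p.1‖ = 1 ∧ ‖p.2‖ = 1 ∧ |p.2 p.1| = 1}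

lemma continuous_state_apply (S : X →L[ℝ] X) :
    Continuous fun p : X × (X →L[ℝ] ℝ) => p.2 (S p.1) :=
  continuous_snd.clm_apply (S.continuous.comp continuous_fst)

lemma isCompact_signedStates [FiniteDimensional ℝ X] : IsCompact (signedStates X) := by
  have : ProperSpace X := FiniteDimensional.proper_real X
  have : ProperSpace (X →L[ℝ] ℝ) := FiniteDimensional.proper_real _
  have hsub : signedStates X = (Metric.sphere (0 : X) 1 ×ˢ Metric.sphere (0 : X →L[ℝ] ℝ) 1) ∩
      {p | |p.2 p.1| = 1} := by
    ext p
    simp [signedStates, and_assoc]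
  rw [hsub]
  exact ((isCompact_sphere _ _).prod (isCompact_sphere _ _)).inter_right
    (isClosed_eq (continuous_snd.clm_apply continuous_fst).abs continuous_const)

lemma apply_le_norm_of_mem_signedStates {p : X × (X →L[ℝ] ℝ)} (hp : p ∈ signedStates X)
    (S : X →L[ℝ] X) : |p.2 (S p.1)| ≤ ‖S‖ := by
  have h1 := p.2.le_opNorm (S p.1)
  have h2 := S.le_opNorm p.1
  rw [hp.2.1, one_mul] at h1
  rw [hp.1, mul_one] at h2
  exact h1.trans h2

lemma apply_le_numericalRadius {p : X × (X →L[ℝ] ℝ)} (hp : p ∈ signedStates X)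
    (S : X →L[ℝ] X) : p.2 (S p.1) ≤ numericalRadius X S := by
  have hbdd : BddAbove {r : ℝ | ∃ (x : X) (f : X →L[ℝ] ℝ),
      ‖x‖ = 1 ∧ ‖f‖ = 1 ∧ f x = 1 ∧ r = ‖f (S x)‖} := by
    refine ⟨‖S‖, ?_⟩
    rintro r ⟨x, f, hx, hf, hfx, rfl⟩
    exact apply_le_norm_of_mem_signedStates (p := (x, f)) ⟨hx, hf, by simp [hfx]⟩ S
  refine (le_abs_self _).trans (le_csSup hbdd ?_)
  rcases eq_or_eq_neg_of_abs_eq hp.2.2 with h | h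
  · exact ⟨p.1, p.2, hp.1, hp.2.1, h, rfl⟩
  · exact ⟨p.1, -p.2, hp.1, by simpa using hp.2.1, by simp [h], by simp⟩

lemma signedStates_nonempty [Nontrivial X] : (signedStates X).Nonempty := by
  obtain ⟨x, hx⟩ := exists_norm_eq X zero_le_one
  obtain ⟨f, hf, hfx⟩ := exists_dual_vector ℝ x (by simp [hx])
  exact ⟨(x, f), hx, hf, by simp [hfx, hx]⟩

lemma exists_apply_eq_numericalRadius [FiniteDimensional ℝ X] [Nontrivial X] (S : X →L[ℝ] X) :
    ∃ p ∈ signedStates X, p.2 (S p.1) = numericalRadius X S := by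
  obtain ⟨p, hp, hmax⟩ := isCompact_signedStates.exists_isMaxOn signedStates_nonempty
    (continuous_state_apply S).continuousOn
  refine ⟨p, hp, le_antisymm (apply_le_numericalRadius hp S) ?_⟩
  obtain ⟨q, hq⟩ := signedStates_nonempty (X := X)
  refine Real.sSup_le ?_ ?_
  · rintro r ⟨x, f, hx, hf, hfx, rfl⟩
    rw [Real.norm_eq_abs]
    refine abs_le'.mpr ⟨?_, ?_⟩
    · exact hmax (a := (x, f)) ⟨hx, hf, by simp [hfx]⟩
    · simpa using hmax (a := (x, -f)) ⟨hx, by simpa using hf, by simp [hfx]⟩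
  · have h1 : q.2 (S q.1) ≤ p.2 (S p.1) := hmax hq
    have h2 : -(q.2 (S q.1)) ≤ p.2 (S p.1) := by
      simpa using hmax (a := (q.1, -q.2)) ⟨hq.1, by simpa using hq.2.1, by simpa using hq.2.2⟩
    linarith

lemma numericalRadius_le_norm [FiniteDimensional ℝ X] [Nontrivial X] (S : X →L[ℝ] X) :
    numericalRadius X S ≤ ‖S‖ := by
  obtain ⟨p, hp, h⟩ := exists_apply_eq_numericalRadius S
  exact h ▸ (le_abs_self _).trans (apply_le_norm_of_mem_signedStates hp S)

lemma numericalRadius_le_add_norm_sub [FiniteDimensional ℝ X] [Nontrivial X]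
    (S T : X →L[ℝ] X) : numericalRadius X S ≤ numericalRadius X T + ‖S - T‖ := by
  obtain ⟨p, hp, h⟩ := exists_apply_eq_numericalRadius S
  have h1 := apply_le_numericalRadius hp T
  have h2 := (le_abs_self _).trans (apply_le_norm_of_mem_signedStates hp (S - T))
  rw [sub_apply, map_sub] at h2
  linarith

lemma continuous_numericalRadius [FiniteDimensional ℝ X] [Nontrivial X] :
    Continuous (numericalRadius X) := by
  refine LipschitzWith.continuous (K := 1) (LipschitzWith.of_dist_le_mul fun S T => ?_)
  have h1 := numericalRadius_le_add_norm_sub S T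
  have h2 := numericalRadius_le_add_norm_sub T S
  rw [norm_sub_rev] at h2
  rw [NNReal.coe_one, one_mul, Real.dist_eq, dist_eq_norm, abs_le]
  constructor <;> linarith

/-- The numerical radius controls `v` on the rank-one operators `x ↦ g x • v`. -/
lemma exists_pos_mul_norm_le_state_smulRight {g : X →L[ℝ] ℝ} {u : X} (hgu : g u = 1) :
    ∃ c > 0, ∀ v : X, g v = 0 → v ≠ 0 →
      ∃ p ∈ signedStates X, c * ‖v‖ ≤ p.2 (g.smulRight v p.1) := by
  have hu : 0 < ‖u‖ := norm_pos_iff.mpr (by rintro rfl; simp at hgu)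
  refine ⟨1 / (10 * ‖u‖), by positivity, fun v hgv hv => ?_⟩
  have hn : 0 < ‖v‖ := norm_pos_iff.mpr hv
  set e : ℝ := ‖v‖ / (4 * ‖u‖) with he
  have he0 : 0 < e := by positivity
  set y : X := v + e • u with hy
  have heu : ‖e • u‖ = ‖v‖ / 4 := by
    rw [norm_smul, Real.norm_of_nonneg he0.le, he]
    field_simp
  have hy_lower : 3 / 4 * ‖v‖ ≤ ‖y‖ := by
    have := norm_sub_le_norm_add v (e • u)
    linarith
  have hy_upper : ‖y‖ ≤ 5 / 4 * ‖v‖ := by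
    have := norm_add_le v (e • u)
    linarith
  have hy0 : 0 < ‖y‖ := by linarith
  obtain ⟨f, hf, hfy⟩ := exists_dual_vector ℝ y hy0.ne'
  have hfy' : f y = ‖y‖ := by simpa using hfy
  have hfv : ‖v‖ / 2 ≤ f v := by
    have h1 : f (e • u) ≤ ‖v‖ / 4 := by
      have := (le_abs_self _).trans (f.le_opNorm (e • u))
      rwa [hf, one_mul, heu] at this
    have h2 : f y = f v + f (e • u) := by rw [hy, map_add]
    linarith
  have hgy : g y = e := by simp [hy, hgv, hgu]
  refine ⟨(‖y‖⁻¹ • y, f), ⟨by simp [norm_smul, hy0.ne'], hf, by simp [hfy', hy0.ne']⟩, ?_⟩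
  simp only [ContinuousLinearMap.smulRight_apply, map_smul, smul_eq_mul, hgy, ← mul_assoc]
  calc 1 / (10 * ‖u‖) * ‖v‖ = (5 / 4 * ‖v‖)⁻¹ * e * (‖v‖ / 2) := by
        rw [he]; field_simp; norm_num
    _ ≤ ‖y‖⁻¹ * e * f v := by gcongr

end NumericalRadius

section Extensions

variable {X : Type*} [NormedAddCommGroup X] [NormedSpace ℝ X] {V : Submodule ℝ X}
  {g : X →L[ℝ] ℝ} {A : V →L[ℝ] V} {A₀ : X →L[ℝ] X}

lemma apply_extension_le {v : X} (hv : v ∈ V) (hA₀ : ∀ v : V, A₀ (v : X) = (A v : X))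
    (f : X →L[ℝ] ℝ) (hf : ‖f‖ = 1) : |f (A₀ v)| ≤ ‖A‖ * ‖v‖ := by
  have h1 := f.le_opNorm (A₀ v)
  have h2 := A.le_opNorm ⟨v, hv⟩
  rw [hf, one_mul] at h1
  have h3 : ‖A₀ v‖ = ‖A ⟨v, hv⟩‖ := by rw [hA₀ ⟨v, hv⟩]; rfl
  rw [h3] at h1
  exact h1.trans h2

lemma functional_ne_zero_of_norm_lt (hker : ∀ x, g x = 0 → x ∈ V)
    (hA₀ : ∀ v : V, A₀ (v : X) = (A v : X)) {l : ℝ} (hl : ‖A‖ < l) {p : X × (X →L[ℝ] ℝ)}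
    (hp : p ∈ signedStates X) (hpl : p.2 (A₀ p.1) = l) : g p.1 ≠ 0 := by
  intro h0
  have := (le_abs_self _).trans (apply_extension_le (hker _ h0) hA₀ p.2 hp.2.1)
  rw [hp.1, mul_one, hpl] at this
  linarith

/-- The linear parts of two extremal pairs are never opposite when the extremal value exceeds
the norm of `A`. -/
lemma extremal_functionals_not_opposite (hker : ∀ x, g x = 0 → x ∈ V)
    (hmem : ∀ x, A₀ x ∈ V) (hA₀ : ∀ v : V, A₀ (v : X) = (A v : X)) {l : ℝ} (hl : ‖A‖ < l)
    {p q : X × (X →L[ℝ] ℝ)} (hp : p ∈ signedStates X) (hq : q ∈ signedStates X)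
    (hpl : p.2 (A₀ p.1) = l) (hql : q.2 (A₀ q.1) = l) {c : ℝ} (hc : 0 ≤ c)
    (h : ∀ v ∈ V, g p.1 * p.2 v = -(c * (g q.1 * q.2 v))) : False := by
  have hgp := functional_ne_zero_of_norm_lt hker hA₀ hl hp hpl
  have hgq := functional_ne_zero_of_norm_lt hker hA₀ hl hq hql
  set s : ℝ := |g p.1|⁻¹ with hs
  set t : ℝ := |g q.1|⁻¹ with ht
  have hs0 : 0 < s := by positivity
  have ht0 : 0 < t := by positivity
  set y : X := (g p.1)⁻¹ • p.1 - (g q.1)⁻¹ • q.1 with hy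
  have hyV : y ∈ V := hker _ (by simp [hy, hgp, hgq])
  have hyn : ‖y‖ ≤ s + t := by
    refine (norm_sub_le _ _).trans ?_
    simp [norm_smul, hp.1, hq.1, hs, ht]
  have hval : g p.1 * p.2 (A₀ y) = (1 + c) * l := by
    have h1 := h _ (hmem q.1)
    rw [hql] at h1
    have h2 : g p.1 * p.2 (A₀ y) =
        p.2 (A₀ p.1) - (g q.1)⁻¹ * (g p.1 * p.2 (A₀ q.1)) := by
      simp only [hy, map_sub, map_smul, smul_eq_mul]
      field_simp
    rw [h2, h1, hpl]
    field_simp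
    ring
  have hA0 := norm_nonneg A
  have hbound : ∀ f : X →L[ℝ] ℝ, ‖f‖ = 1 → |f (A₀ y)| ≤ ‖A‖ * (s + t) := fun f hf =>
    (apply_extension_le hyV hA₀ f hf).trans (by gcongr)
  have e1 : (1 + c) * l * s ≤ ‖A‖ * (s + t) := by
    calc (1 + c) * l * s ≤ |g p.1 * p.2 (A₀ y)| * s := by
          rw [← hval]; gcongr; exact le_abs_self _
      _ = |p.2 (A₀ y)| := by rw [abs_mul, hs]; field_simp
      _ ≤ _ := hbound _ hp.2.1
  have e2 : (1 + c) * l * t ≤ c * (‖A‖ * (s + t)) := by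
    calc (1 + c) * l * t ≤ |c * (g q.1 * q.2 (A₀ y))| * t := by
          rw [← hval, h _ (hmem y)]; gcongr; exact neg_le_abs _
      _ = c * |q.2 (A₀ y)| := by rw [abs_mul, abs_mul, abs_of_nonneg hc, ht]; field_simp
      _ ≤ _ := by gcongr; exact hbound _ hq.2.1
  have : 0 < (1 + c) * (l - ‖A‖) * (s + t) := by
    have : 0 < l - ‖A‖ := by linarith
    positivity
  nlinarith

lemma exists_functional_eq_zero_iff_mem (hX : Module.finrank ℝ X = 3)
    (hV : Module.finrank ℝ V = 2) :
    ∃ (g : X →L[ℝ] ℝ) (u : X), g u = 1 ∧ ∀ x, g x = 0 ↔ x ∈ V := by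
  have : FiniteDimensional ℝ X := FiniteDimensional.of_finrank_pos (by omega)
  have hlt : V < ⊤ := by
    refine lt_top_iff_ne_top.mpr ?_
    rintro rfl
    rw [finrank_top] at hV
    omega
  obtain ⟨f, hf, hVf⟩ := V.exists_le_ker_of_lt_top hlt
  obtain ⟨w, hw⟩ : ∃ w, f w ≠ 0 := by
    by_contra! h
    exact hf (LinearMap.ext h)
  have hrange : Module.finrank ℝ (LinearMap.range f) = 1 := by
    rw [LinearMap.range_eq_top.mpr (LinearMap.surjective hf), finrank_top, Module.finrank_self]
  have hrank := f.finrank_range_add_finrank_ker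
  have hker : V = LinearMap.ker f := Submodule.eq_of_le_of_finrank_eq hVf (by omega)
  refine ⟨LinearMap.toContinuousLinearMap f, (f w)⁻¹ • w, by simp [hw], fun x => ?_⟩
  rw [hker]
  simp

lemma exists_extension [FiniteDimensional ℝ X] (A : V →L[ℝ] V) :
    ∃ B : X →L[ℝ] X, (∀ x, B x ∈ V) ∧ ∀ v : V, B (v : X) = (A v : X) := by
  obtain ⟨B, hB⟩ := LinearMap.exists_extend (A : V →ₗ[ℝ] V)
  refine ⟨LinearMap.toContinuousLinearMap (V.subtype ∘ₗ B), fun x => by simp, fun v => ?_⟩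
  have := LinearMap.congr_fun hB v
  simpa using congrArg Subtype.val this

lemma eq_add_smulRight {u : X} (hgu : g u = 1) (hker : ∀ x, g x = 0 ↔ x ∈ V)
    {B : X →L[ℝ] X} (hA₀ : ∀ v : V, A₀ (v : X) = (A v : X))
    (hB : ∀ v : V, B (v : X) = (A v : X)) : B = A₀ + g.smulRight (B u - A₀ u) := by
  ext x
  have hx : x - g x • u ∈ V := (hker _).mp (by simp [hgu])
  have h1 := (hB ⟨_, hx⟩).trans (hA₀ ⟨_, hx⟩).symm
  simp only [map_sub, map_smul] at h1
  simp only [add_apply, ContinuousLinearMap.smulRight_apply, smul_sub]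
  rw [sub_eq_iff_eq_add] at h1
  rw [h1]
  abel

lemma extension_add_smulRight (hker : ∀ x, g x = 0 ↔ x ∈ V) (hmem : ∀ x, A₀ x ∈ V)
    (hA₀ : ∀ v : V, A₀ (v : X) = (A v : X)) {v : X} (hv : v ∈ V) :
    (∀ x, (A₀ + g.smulRight v) x ∈ V) ∧ ∀ y : V, (A₀ + g.smulRight v) (y : X) = (A y : X) :=
  ⟨fun x => V.add_mem (hmem x) (V.smul_mem _ hv), fun y => by
    simp [hA₀ y, (hker y).mpr y.2]⟩

lemma exists_minimal_extension [FiniteDimensional ℝ X] [Nontrivial X] {u : X} (hgu : g u = 1)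
    (hker : ∀ x, g x = 0 ↔ x ∈ V) (A : V →L[ℝ] V) :
    ∃ A₀ : X →L[ℝ] X, (∀ x, A₀ x ∈ V) ∧ (∀ v : V, A₀ (v : X) = (A v : X)) ∧
      ∀ B : X →L[ℝ] X, (∀ x, B x ∈ V) → (∀ v : V, B (v : X) = (A v : X)) →
        numericalRadius X A₀ ≤ numericalRadius X B := by
  obtain ⟨A₁, hmem, hA₁⟩ := exists_extension A
  obtain ⟨c, hc, hstate⟩ := exists_pos_mul_norm_le_state_smulRight hgu
  have : ProperSpace V := FiniteDimensional.proper_real V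
  set F : V → ℝ := fun v => numericalRadius X (A₁ + g.smulRight (v : X))
  have hFc : Continuous F := by
    refine continuous_numericalRadius.comp (continuous_const.add ?_)
    exact (ContinuousLinearMap.smulRightL ℝ X X g).continuous.comp continuous_subtype_val
  have hlow : ∀ v : V, v ≠ 0 → c * ‖v‖ - ‖A₁‖ ≤ F v := by
    intro v hv
    obtain ⟨p, hp, hpv⟩ := hstate v ((hker _).mpr v.2) (by simpa using hv)
    have h1 := apply_le_numericalRadius hp (A₁ + g.smulRight (v : X))
    have h2 := (abs_le.mp (apply_le_norm_of_mem_signedStates hp A₁)).1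
    rw [add_apply, map_add] at h1
    rw [← Submodule.coe_norm] at hpv
    linarith
  have hlim : Tendsto F (cocompact V) atTop := by
    refine tendsto_atTop_mono' _ (f₁ := fun v => c * ‖v‖ - ‖A₁‖) ?_ ?_
    · filter_upwards [(isCompact_singleton (x := (0 : V))).compl_mem_cocompact] with v hv
      exact hlow v hv
    · exact tendsto_atTop_add_const_right _ _
        ((tendsto_norm_cocompact_atTop (E := V)).const_mul_atTop hc)
  obtain ⟨v, hv⟩ := hFc.exists_forall_le hlim
  obtain ⟨h1, h2⟩ := extension_add_smulRight hker hmem hA₁ v.2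
  refine ⟨_, h1, h2, fun B hB hBA => ?_⟩
  rw [eq_add_smulRight hgu hker hA₁ hBA]
  exact hv ⟨B u - A₁ u, V.sub_mem (hB u) (hmem u)⟩

lemma strongly_minimal_extension (hX : Module.finrank ℝ X = 3) (hV : Module.finrank ℝ V = 2)
    {u : X} (hgu : g u = 1) (hker : ∀ x, g x = 0 ↔ x ∈ V) (hmem : ∀ x, A₀ x ∈ V)
    (hA₀ : ∀ v : V, A₀ (v : X) = (A v : X)) (hlt : ‖A‖ < numericalRadius X A₀)
    (hmin : ∀ B : X →L[ℝ] X, (∀ x, B x ∈ V) → (∀ v : V, B (v : X) = (A v : X)) →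
      numericalRadius X A₀ ≤ numericalRadius X B) :
    ∃ r > 0, ∀ B : X →L[ℝ] X, (∀ x, B x ∈ V) → (∀ v : V, B (v : X) = (A v : X)) →
      numericalRadius X A₀ + r * ‖B - A₀‖ ≤ numericalRadius X B := by
  have : FiniteDimensional ℝ X := FiniteDimensional.of_finrank_pos (by omega)
  have : Nontrivial X := Module.nontrivial_of_finrank_pos (R := ℝ) (by omega)
  have hg : 0 < ‖g‖ := norm_pos_iff.mpr (by rintro rfl; simp at hgu)
  have hφ : Continuous fun p : X × (X →L[ℝ] ℝ) => g p.1 • p.2.comp V.subtypeL :=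
    (g.continuous.comp continuous_fst).smul (continuous_snd.clm_comp continuous_const)
  obtain ⟨m, hm, hstrong⟩ := exists_pos_strong_minimum hV isCompact_signedStates
    (continuous_state_apply A₀) hφ (fun p hp => apply_le_numericalRadius hp A₀)
    (fun v => by
      obtain ⟨h1, h2⟩ := extension_add_smulRight hker hmem hA₀ v.2
      obtain ⟨p, hp, hpv⟩ := exists_apply_eq_numericalRadius (A₀ + g.smulRight (v : X))
      refine ⟨p, hp, (hmin _ h1 h2).trans (hpv.symm.le.trans ?_)⟩
      simp)
    (fun p hp q hq hpl hql c hc h =>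
      extremal_functionals_not_opposite (fun x => (hker x).mp) hmem hA₀ hlt hp hq hpl hql hc
        fun v hv => by simpa using DFunLike.congr_fun h (⟨v, hv⟩ : V))
  refine ⟨m / ‖g‖, by positivity, fun B hB hBA => ?_⟩
  set v : V := ⟨B u - A₀ u, V.sub_mem (hB u) (hmem u)⟩
  have hBeq : B = A₀ + g.smulRight (v : X) := eq_add_smulRight hgu hker hA₀ hBA
  obtain ⟨p, hp, hpl, hpm⟩ := hstrong v
  have hnorm : ‖B - A₀‖ = ‖g‖ * ‖v‖ := by
    rw [hBeq, add_sub_cancel_left, ContinuousLinearMap.norm_smulRight_apply]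
    rfl
  have hle := apply_le_numericalRadius hp B
  have hsplit : p.2 (B p.1) = p.2 (A₀ p.1) + (g p.1 • p.2.comp V.subtypeL) v := by
    rw [hBeq]
    simp
  rw [hnorm, ← mul_assoc, div_mul_cancel₀ _ hg.ne']
  linarith

end Extensions

/-- Aksoy–Lewicki: let `X` be a three-dimensional real Banach space, `V` a
two-dimensional subspace, `A ∈ B(V)` with `‖A‖_w > 0`, and suppose
`λ_w^A = inf {‖B‖_w : B ∈ 𝒫_A(X,V)} > ‖A‖`. Then there is exactly one extension
`A₀ ∈ 𝒫_A(X,V)` with `‖A₀‖_w = λ_w^A`, and `A₀` is a strongly unique minimal extension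
with respect to the numerical radius. -/
theorem strongly_unique_minimal_extension_numericalRadius
    {X : Type*} [NormedAddCommGroup X] [NormedSpace ℝ X]
    (hX : Module.finrank ℝ X = 3)
    (V : Submodule ℝ X) (hV : Module.finrank ℝ V = 2)
    (A : V →L[ℝ] V) (hA : 0 < numericalRadius V A)
    (l : ℝ)
    (hl : l = sInf {r : ℝ | ∃ B : X →L[ℝ] X, (∀ x : X, B x ∈ V) ∧
      (∀ v : V, B (v : X) = (A v : X)) ∧ r = numericalRadius X B})
    (hlA : ‖A‖ < l) :
    (∃! A₀ : X →L[ℝ] X, (∀ x : X, A₀ x ∈ V) ∧ (∀ v : V, A₀ (v : X) = (A v : X)) ∧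
      numericalRadius X A₀ = l) ∧
    (∀ A₀ : X →L[ℝ] X, (∀ x : X, A₀ x ∈ V) → (∀ v : V, A₀ (v : X) = (A v : X)) →
      numericalRadius X A₀ = l →
      ∃ r : ℝ, 0 < r ∧ ∀ B : X →L[ℝ] X, (∀ x : X, B x ∈ V) →
        (∀ v : V, B (v : X) = (A v : X)) →
        numericalRadius X A₀ + r * numericalRadius X (B - A₀) ≤ numericalRadius X B) := by
  have : FiniteDimensional ℝ X := FiniteDimensional.of_finrank_pos (by omega)
  have : Nontrivial X := Module.nontrivial_of_finrank_pos (R := ℝ) (by omega)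
  obtain ⟨g, u, hgu, hker⟩ := exists_functional_eq_zero_iff_mem hX hV
  obtain ⟨A₁, hmem, hext, hmin⟩ := exists_minimal_extension hgu hker A
  have hl₁ : numericalRadius X A₁ = l := by
    rw [hl]
    symm
    apply IsLeast.csInf_eq
    refine ⟨⟨A₁, hmem, hext, rfl⟩, ?_⟩
    rintro r ⟨B, hB, hBA, rfl⟩
    exact hmin B hB hBA
  have strong : ∀ A₀ : X →L[ℝ] X, (∀ x, A₀ x ∈ V) → (∀ v : V, A₀ (v : X) = (A v : X)) →
      numericalRadius X A₀ = l → ∃ r > 0, ∀ B : X →L[ℝ] X, (∀ x, B x ∈ V) →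
        (∀ v : V, B (v : X) = (A v : X)) →
        numericalRadius X A₀ + r * ‖B - A₀‖ ≤ numericalRadius X B := fun A₀ h1 h2 h3 =>
    strongly_minimal_extension hX hV hgu hker h1 h2 (h3 ▸ hlA) fun B hB hBA =>
      h3.trans hl₁.symm ▸ hmin B hB hBA
  refine ⟨⟨A₁, ⟨hmem, hext, hl₁⟩, ?_⟩, fun A₀ h1 h2 h3 => ?_⟩
  · rintro B ⟨hB, hBA, hBl⟩
    obtain ⟨r, hr, h⟩ := strong A₁ hmem hext hl₁
    have h0 := h B hB hBA
    rw [hl₁, hBl] at h0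
    have : ‖B - A₁‖ ≤ 0 := nonpos_of_mul_nonpos_right (by linarith) hr
    exact sub_eq_zero.mp (norm_le_zero_iff.mp this)
  · obtain ⟨r, hr, h⟩ := strong A₀ h1 h2 h3
    refine ⟨r, hr, fun B hB hBA => le_trans ?_ (h B hB hBA)⟩
    gcongr
    exact numericalRadius_le_norm _
end
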